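/- arXiv:0905.0719 — 5 statements merged into one kernel-verified Lean document; each statement's English description precedes it below -/
import Mathlib

section
/- In the square model there is a hyperbolic point: there exist a line L of the square geometry and a point N of the square not lying on L such that infinitely many lines of the square geometry pass through N and are parallel to (i.e., disjoint from) L. -/
/-- The closed unit square `[0,1] × [0,1]` in `ℝ²`. -/
def SqSpace : Set (ℝ × ℝ) := Set.Icc (0 : ℝ) 1 ×ˢ Set.Icc (0 : ℝ) 1

/-- A "line" of the square geometry joining the bottom side to the top side. -/
def SqLineBT (L : Set (ℝ × ℝ)) : Prop :=
  ∃ p q : ℝ × ℝ, L = segment ℝ p q ∧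
    p.1 ∈ Set.Icc (0 : ℝ) 1 ∧ p.2 = 0 ∧ q.1 ∈ Set.Icc (0 : ℝ) 1 ∧ q.2 = 1

/-- A "line" of the square geometry joining the left side to the right side. -/
def SqLineLR (L : Set (ℝ × ℝ)) : Prop :=
  ∃ p q : ℝ × ℝ, L = segment ℝ p q ∧
    p.1 = 0 ∧ p.2 ∈ Set.Icc (0 : ℝ) 1 ∧ q.1 = 1 ∧ q.2 ∈ Set.Icc (0 : ℝ) 1

/-- A "line" of the square geometry: a segment whose endpoints lie on
opposite sides of the unit square. -/
def SqLine (L : Set (ℝ × ℝ)) : Prop := SqLineBT L ∨ SqLineLR L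

/-- Two lines of the square geometry are parallel if they are distinct and disjoint. -/
def SqParallel (L₁ L₂ : Set (ℝ × ℝ)) : Prop := L₁ ≠ L₂ ∧ Disjoint L₁ L₂

/-- Segments from `(1, 0)` to different points of the line `y = 1` are different. -/
theorem segment_to_height_one_injective :
    Function.Injective fun t : ℝ => segment ℝ ((1, 0) : ℝ × ℝ) (t, 1) := by
  intro s t hst
  have hmem : ((s, 1) : ℝ × ℝ) ∈ segment ℝ ((1, 0) : ℝ × ℝ) (t, 1) := by
    have h := right_mem_segment ℝ ((1, 0) : ℝ × ℝ) (s, 1)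
    rwa [show segment ℝ ((1, 0) : ℝ × ℝ) (s, 1) = segment ℝ (1, 0) (t, 1) from hst] at h
  obtain ⟨a, b, -, -, hab, h⟩ := hmem
  simp only [Prod.smul_mk, Prod.mk_add_mk, Prod.mk.injEq, smul_eq_mul] at h
  obtain ⟨h₁, h₂⟩ := h
  obtain rfl : b = 1 := by linarith
  obtain rfl : a = 0 := by linarith
  linarith

/-- Points of the left side of the square have abscissa zero. -/
theorem fst_eq_zero_of_mem_left_side {x : ℝ × ℝ}
    (hx : x ∈ segment ℝ ((0, 0) : ℝ × ℝ) (0, 1)) : x.1 = 0 := by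
  obtain ⟨a, b, -, -, -, rfl⟩ := hx
  simp

/-- A segment between two points of positive abscissa misses the left side of the square. -/
theorem disjoint_segment_left_side {p q : ℝ × ℝ} (hp : 0 < p.1) (hq : 0 < q.1) :
    Disjoint (segment ℝ p q) (segment ℝ ((0, 0) : ℝ × ℝ) (0, 1)) := by
  have hconv : Convex ℝ {x : ℝ × ℝ | 0 < x.1} :=
    convex_halfSpace_gt (LinearMap.fst ℝ ℝ ℝ).isLinear 0
  rw [Set.disjoint_left]
  intro x hx hx'
  exact (hconv.segment_subset hp hq hx).ne' (fst_eq_zero_of_mem_left_side hx')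

/-- In the square model there is a hyperbolic point: there exist a
line `L` of the square geometry and a point `N` of the square not on `L` such
that infinitely many lines of the square geometry pass through `N` and are
parallel to `L`. -/
theorem square_model_hyperbolic_point :
    ∃ (L : Set (ℝ × ℝ)) (N : ℝ × ℝ), SqLine L ∧ N ∈ SqSpace ∧ N ∉ L ∧
      {L' : Set (ℝ × ℝ) | SqLine L' ∧ N ∈ L' ∧ SqParallel L' L}.Infinite := by
  refine ⟨segment ℝ (0, 0) (0, 1), (1, 0), Or.inl ⟨(0, 0), (0, 1), rfl, by simp⟩,
    by simp [SqSpace], fun h => one_ne_zero (fst_eq_zero_of_mem_left_side h), ?_⟩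
  refine ((Set.Ioc_infinite (zero_lt_one' ℝ)).image
    segment_to_height_one_injective.injOn).mono ?_
  rintro _ ⟨t, ht, rfl⟩
  have hdisj := disjoint_segment_left_side (p := (1, 0)) (q := (t, 1)) one_pos ht.1
  exact ⟨Or.inl ⟨(1, 0), (t, 1), rfl, by simp, rfl, ⟨ht.1.le, ht.2⟩, rfl⟩,
    left_mem_segment ℝ _ _, hdisj.ne (Set.nonempty_iff_ne_empty.1 ⟨_, left_mem_segment ℝ _ _⟩),
    hdisj⟩
end

section
/- In the square model there is a Euclidean point: there exist a line L of the square geometry and a point M of the square not lying on L such that there is exactly one line of the square geometry passing through M that is parallel to (i.e., disjoint from) L. -/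
/-- The vertical segment of height one above `(x, 0)` consists of the points `(x, y)`, `y ∈ [0,1]`. -/
lemma mem_segment_vertical_iff (x : ℝ) (P : ℝ × ℝ) :
    P ∈ segment ℝ (x, (0 : ℝ)) (x, (1 : ℝ)) ↔ P.1 = x ∧ P.2 ∈ Set.Icc (0 : ℝ) 1 := by
  rw [← Prod.image_mk_segment_right, segment_eq_Icc zero_le_one]
  obtain ⟨a, b⟩ := P
  simp only [Set.mem_image, Prod.mk.injEq]
  constructor
  · rintro ⟨y, hy, rfl, rfl⟩
    exact ⟨rfl, hy⟩
  · rintro ⟨rfl, hb⟩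
    exact ⟨b, hb, rfl, rfl⟩

/-- In the square model there is a Euclidean point: there exist a
line `L` of the square geometry and a point `M` of the square not on `L` such
that exactly one line of the square geometry through `M` is parallel to `L`. -/
theorem square_model_euclidean_point :
    ∃ (L : Set (ℝ × ℝ)) (M : ℝ × ℝ), SqLine L ∧ M ∈ SqSpace ∧ M ∉ L ∧
      ∃! L' : Set (ℝ × ℝ), SqLine L' ∧ M ∈ L' ∧ SqParallel L' L := by
  refine ⟨segment ℝ (0, 0) (0, 1), (1, 1 / 2), Or.inl ⟨_, _, rfl, by simp⟩,
    by norm_num [SqSpace], by simp [mem_segment_vertical_iff],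
    segment ℝ (1, 0) (1, 1), ⟨Or.inl ⟨_, _, rfl, by simp⟩, ?_, ?_⟩, ?_⟩
  · rw [mem_segment_vertical_iff]
    norm_num
  · have hdisj : Disjoint (segment ℝ ((1 : ℝ), (0 : ℝ)) (1, 1)) (segment ℝ (0, 0) (0, 1)) := by
      rw [Set.disjoint_left]
      intro P hP hP'
      rw [mem_segment_vertical_iff] at hP hP'
      linarith [hP.1, hP'.1]
    exact ⟨hdisj.ne (Set.nonempty_iff_ne_empty.mp ⟨_, left_mem_segment ℝ _ _⟩), hdisj⟩
  · rintro L' ⟨⟨⟨a, s⟩, ⟨b, t⟩, rfl, ha, rfl, hb, rfl⟩ | ⟨p, q, rfl, hp, hp', -, -⟩, hM, -, hdisj⟩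
    · obtain ⟨u, v, hu, hv, huv, h⟩ := hM
      simp only [Prod.smul_mk, smul_eq_mul, Prod.mk_add_mk, Prod.mk.injEq] at h
      obtain ⟨h₁, h₂⟩ := h
      obtain rfl : v = 1 / 2 := by linarith
      obtain rfl : u = 1 / 2 := by linarith
      obtain rfl : a = 1 := by linarith [ha.2, hb.2]
      obtain rfl : b = 1 := by linarith
      rfl
    · exact absurd ((mem_segment_vertical_iff 0 p).mpr ⟨hp, hp'⟩)
        (Set.disjoint_left.mp hdisj (left_mem_segment ℝ p q))
end

section
/- In the square model there is an elliptic point: there exist a line L of the square geometry and a point D of the square not lying on L such that every line of the square geometry passing through D intersects L, i.e., no line through D is parallel to L. -/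
/-- An affine self-map of `[0,1]` has a fixed point. -/
lemma exists_affine_fixedPoint_unitInterval {a b : ℝ} (ha : a ∈ Set.Icc (0 : ℝ) 1)
    (hb : b ∈ Set.Icc (0 : ℝ) 1) : ∃ t ∈ Set.Icc (0 : ℝ) 1, a + t * (b - a) = t := by
  obtain ⟨ha0, ha1⟩ := ha
  obtain ⟨hb0, hb1⟩ := hb
  rcases (show 0 ≤ 1 + a - b by linarith).eq_or_lt with h | h
  · exact ⟨0, by simp, by linarith⟩
  · refine ⟨a / (1 + a - b), ⟨by positivity, (div_le_one h).2 (by linarith)⟩, ?_⟩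
    field_simp
    ring

lemma mem_segment_diagonal {t : ℝ} (ht : t ∈ Set.Icc (0 : ℝ) 1) :
    (t, t) ∈ segment ℝ ((0, 0) : ℝ × ℝ) (1, 1) := by
  rw [segment_eq_image']
  exact ⟨t, ht, by simp⟩

/-- Every line of the square geometry meets the main diagonal. -/
lemma SqLine.inter_diagonal_nonempty {L : Set (ℝ × ℝ)} (hL : SqLine L) :
    (L ∩ segment ℝ ((0, 0) : ℝ × ℝ) (1, 1)).Nonempty := by
  rcases hL with ⟨⟨p₁, p₂⟩, ⟨q₁, q₂⟩, rfl, hp, rfl, hq, rfl⟩ |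
    ⟨⟨p₁, p₂⟩, ⟨q₁, q₂⟩, rfl, rfl, hp, rfl, hq⟩
  all_goals
    obtain ⟨t, ht, h⟩ := exists_affine_fixedPoint_unitInterval hp hq
    refine ⟨(t, t), ?_, mem_segment_diagonal ht⟩
    rw [segment_eq_image']
    exact ⟨t, ht, by simpa using h⟩

/-- In the square model there is an elliptic point: there exist a
line `L` of the square geometry and a point `D` of the square not on `L` such
that every line of the square geometry through `D` intersects `L`, i.e. no line
through `D` is parallel to `L`. -/
theorem square_model_elliptic_point :
    ∃ (L : Set (ℝ × ℝ)) (D : ℝ × ℝ), SqLine L ∧ D ∈ SqSpace ∧ D ∉ L ∧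
      ∀ L' : Set (ℝ × ℝ), SqLine L' → D ∈ L' →
        (L' ∩ L).Nonempty ∧ ¬ SqParallel L' L := by
  refine ⟨segment ℝ (0, 0) (1, 1), (1, 0),
    Or.inl ⟨(0, 0), (1, 1), rfl, by simp, rfl, by simp, rfl⟩, by simp [SqSpace], ?_, ?_⟩
  · rw [segment_eq_image']
    rintro ⟨t, -, h⟩
    simp only [Prod.ext_iff] at h
    norm_num at h
    linarith [h.1, h.2]
  · intro L' hL' _
    have h := hL'.inter_diagonal_nonempty
    exact ⟨h, fun hpar => Set.not_disjoint_iff_nonempty_inter.2 h hpar.2⟩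
end

section
/- The square model is a Smarandache geometry with respect to the parallel axiom: there exist a single line L of the square geometry and three points M, N, D of the square, each not lying on L, such that exactly one line of the square geometry through M is parallel to L, infinitely many lines of the square geometry through N are parallel to L, and no line of the square geometry through D is parallel to L. Thus the Euclidean parallel postulate is validated at M and invalidated in two distinct ways (at N and at D) within the same space. -/
theorem mem_segment_prod_iff {p q z : ℝ × ℝ} :
    z ∈ segment ℝ p q ↔ ∃ t ∈ Set.Icc (0 : ℝ) 1,
      z.1 = (1 - t) * p.1 + t * q.1 ∧ z.2 = (1 - t) * p.2 + t * q.2 := by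
  rw [segment_eq_image]
  constructor
  · rintro ⟨t, ht, rfl⟩
    exact ⟨t, ht, by simp, by simp⟩
  · rintro ⟨t, ht, h₁, h₂⟩
    exact ⟨t, ht, Prod.ext (by simp [h₁]) (by simp [h₂])⟩

theorem mem_segment_bottom_top_iff {p q z : ℝ × ℝ} (hp : p.2 = 0) (hq : q.2 = 1) :
    z ∈ segment ℝ p q ↔
      z.2 ∈ Set.Icc (0 : ℝ) 1 ∧ z.1 = (1 - z.2) * p.1 + z.2 * q.1 := by
  rw [mem_segment_prod_iff, hp, hq]
  constructor
  · rintro ⟨t, ht, h₁, h₂⟩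
    obtain rfl : z.2 = t := by linarith
    exact ⟨ht, h₁⟩
  · rintro ⟨ht, h₁⟩
    exact ⟨z.2, ht, h₁, by ring⟩

theorem mem_segment_left_right_iff {p q z : ℝ × ℝ} (hp : p.1 = 0) (hq : q.1 = 1) :
    z ∈ segment ℝ p q ↔
      z.1 ∈ Set.Icc (0 : ℝ) 1 ∧ z.2 = (1 - z.1) * p.2 + z.1 * q.2 := by
  rw [mem_segment_prod_iff, hp, hq]
  constructor
  · rintro ⟨t, ht, h₁, h₂⟩
    obtain rfl : z.1 = t := by linarith
    exact ⟨ht, h₂⟩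
  · rintro ⟨ht, h₂⟩
    exact ⟨z.1, ht, by ring, h₂⟩

/-- The line joining `(a, 0)` to `(b, 1)`. -/
def bottomTopSegment (a b : ℝ) : Set (ℝ × ℝ) := segment ℝ (a, 0) (b, 1)

theorem mem_bottomTopSegment {a b : ℝ} {z : ℝ × ℝ} :
    z ∈ bottomTopSegment a b ↔
      z.2 ∈ Set.Icc (0 : ℝ) 1 ∧ z.1 = (1 - z.2) * a + z.2 * b :=
  mem_segment_bottom_top_iff rfl rfl

theorem sqLine_bottomTopSegment {a b : ℝ} (ha : a ∈ Set.Icc (0 : ℝ) 1)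
    (hb : b ∈ Set.Icc (0 : ℝ) 1) : SqLine (bottomTopSegment a b) :=
  Or.inl ⟨_, _, rfl, ha, rfl, hb, rfl⟩

theorem SqLineBT.exists_eq_bottomTopSegment {L : Set (ℝ × ℝ)} (h : SqLineBT L) :
    ∃ a ∈ Set.Icc (0 : ℝ) 1, ∃ b ∈ Set.Icc (0 : ℝ) 1, L = bottomTopSegment a b := by
  obtain ⟨⟨a, y⟩, ⟨b, y'⟩, rfl, ha, rfl, hb, rfl⟩ := h
  exact ⟨a, ha, b, hb, rfl⟩

theorem bottomTopSegment_injective_right (a : ℝ) :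
    Function.Injective (bottomTopSegment a) := by
  intro b c h
  have hb : ((b, 1) : ℝ × ℝ) ∈ bottomTopSegment a c := by
    rw [← h]
    exact right_mem_segment ℝ _ _
  simpa using (mem_bottomTopSegment.1 hb).2

theorem sqParallel_bottomTopSegment {a b c d : ℝ} (hac : c < a) (hbd : d < b) :
    SqParallel (bottomTopSegment a b) (bottomTopSegment c d) := by
  have hdisj : Disjoint (bottomTopSegment a b) (bottomTopSegment c d) := by
    rw [Set.disjoint_left]
    intro z hz hz'
    obtain ⟨⟨h₀, h₁⟩, hz⟩ := mem_bottomTopSegment.1 hz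
    obtain ⟨-, hz'⟩ := mem_bottomTopSegment.1 hz'
    rcases h₀.eq_or_lt with h | h
    · rw [← h] at hz hz'
      linarith
    · nlinarith
  refine ⟨fun h => ?_, hdisj⟩
  have ha : ((a, 0) : ℝ × ℝ) ∈ bottomTopSegment a b := left_mem_segment ℝ _ _
  exact Set.disjoint_left.1 hdisj ha (h ▸ ha)

/-- A left-right line meets the line joining `(1/2, 0)` to `(0, 1)`. -/
theorem SqLineLR.not_sqParallel {L : Set (ℝ × ℝ)} (h : SqLineLR L) :
    ¬ SqParallel L (bottomTopSegment (1 / 2) 0) := by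
  obtain ⟨⟨x, u⟩, ⟨x', v⟩, rfl, rfl, ⟨hu₀, hu₁⟩, rfl, ⟨hv₀, hv₁⟩⟩ := h
  rintro ⟨-, hdisj⟩
  dsimp only at hu₀ hu₁ hv₀ hv₁
  have hpos : 0 < 2 + v - u := by linarith
  obtain ⟨x, hx⟩ : ∃ x, x = (1 - u) / (2 + v - u) := ⟨_, rfl⟩
  have hx₀ : 0 ≤ x := hx ▸ div_nonneg (by linarith) hpos.le
  have hx₁ : x ≤ 1 := by
    rw [hx, div_le_one hpos]
    linarith
  rw [eq_div_iff hpos.ne'] at hx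
  refine Set.not_disjoint_iff.2 ⟨(x, (1 - x) * u + x * v),
    (mem_segment_left_right_iff rfl rfl).2 ⟨⟨hx₀, hx₁⟩, rfl⟩,
    mem_bottomTopSegment.2 ⟨⟨?_, ?_⟩, ?_⟩⟩ hdisj
  · dsimp only
    nlinarith
  · dsimp only
    nlinarith
  · dsimp only
    linarith

/-- The square model is a Smarandache geometry with respect to the
parallel axiom: there are a single line `L` and three points `M`, `N`, `D` of
the square, none on `L`, such that exactly one line through `M` is parallel to
`L`, infinitely many lines through `N` are parallel to `L`, and no line through
`D` is parallel to `L`. -/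
theorem square_model_smarandache_geometry :
    ∃ (L : Set (ℝ × ℝ)) (M N D : ℝ × ℝ), SqLine L ∧
      M ∈ SqSpace ∧ M ∉ L ∧
      N ∈ SqSpace ∧ N ∉ L ∧
      D ∈ SqSpace ∧ D ∉ L ∧
      (∃! L' : Set (ℝ × ℝ), SqLine L' ∧ M ∈ L' ∧ SqParallel L' L) ∧
      {L' : Set (ℝ × ℝ) | SqLine L' ∧ N ∈ L' ∧ SqParallel L' L}.Infinite ∧
      (∀ L' : Set (ℝ × ℝ), SqLine L' → D ∈ L' → ¬ SqParallel L' L) := by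
  refine ⟨bottomTopSegment (1 / 2) 0, (1, 1 / 2), (1, 0), (0, 0),
    sqLine_bottomTopSegment (by norm_num) (by norm_num),
    by norm_num [SqSpace], by norm_num [mem_bottomTopSegment],
    by norm_num [SqSpace], by norm_num [mem_bottomTopSegment],
    by norm_num [SqSpace], by norm_num [mem_bottomTopSegment], ?_, ?_, ?_⟩
  · refine ⟨bottomTopSegment 1 1,
      ⟨sqLine_bottomTopSegment (by norm_num) (by norm_num),
        by norm_num [mem_bottomTopSegment],
        sqParallel_bottomTopSegment (by norm_num) (by norm_num)⟩, ?_⟩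
    rintro L' ⟨hBT | hLR, hM, hpar⟩
    · obtain ⟨a, ⟨-, ha⟩, b, ⟨-, hb⟩, rfl⟩ := hBT.exists_eq_bottomTopSegment
      have h := (mem_bottomTopSegment.1 hM).2
      dsimp only at h
      obtain rfl : a = 1 := by linarith
      obtain rfl : b = 1 := by linarith
      rfl
    · exact absurd hpar hLR.not_sqParallel
  · refine ((Set.Ioc_infinite (zero_lt_one' ℝ)).image
      (bottomTopSegment_injective_right 1).injOn).mono ?_
    rintro _ ⟨b, ⟨hb₀, hb₁⟩, rfl⟩
    exact ⟨sqLine_bottomTopSegment (by norm_num) ⟨hb₀.le, hb₁⟩,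
      left_mem_segment ℝ _ _, sqParallel_bottomTopSegment (by norm_num) hb₀⟩
  · rintro L' (hBT | hLR) hD hpar
    · obtain ⟨a, -, b, ⟨hb, -⟩, rfl⟩ := hBT.exists_eq_bottomTopSegment
      have h := (mem_bottomTopSegment.1 hD).2
      dsimp only at h
      obtain rfl : a = 0 := by linarith
      have hpos : 0 < 2 * b + 1 := by linarith
      obtain ⟨t, ht⟩ : ∃ t, t = 1 / (2 * b + 1) := ⟨_, rfl⟩
      have ht₀ : 0 ≤ t := ht ▸ div_nonneg zero_le_one hpos.le
      have ht₁ : t ≤ 1 := by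
        rw [ht, div_le_one hpos]
        linarith
      rw [eq_div_iff hpos.ne'] at ht
      refine Set.not_disjoint_iff.2 ⟨(t * b, t),
        mem_bottomTopSegment.2 ⟨⟨ht₀, ht₁⟩, ?_⟩,
        mem_bottomTopSegment.2 ⟨⟨ht₀, ht₁⟩, ?_⟩⟩ hpar.2
      · dsimp only
        ring
      · dsimp only
        linarith
    · exact hLR.not_sqParallel hpar
end

section
/- In the square model, through any point M lying in the interior of the bottom side of the square (i.e., M = (m, 0) with 0 < m < 1) there passes exactly one line of the square geometry whose endpoints lie on the left and right sides, namely the bottom side [0,1] × {0} itself; every other line of the square geometry through M has its endpoints on the bottom and top sides. -/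
/-- A left-right line through an interior point of the bottom side is the bottom side. -/
theorem SqLineLR.eq_bottom_side {m : ℝ} (hm0 : 0 < m) (hm1 : m < 1) {L : Set (ℝ × ℝ)}
    (hL : SqLineLR L) (hM : ((m, 0) : ℝ × ℝ) ∈ L) :
    L = segment ℝ ((0 : ℝ), (0 : ℝ)) ((1 : ℝ), (0 : ℝ)) := by
  obtain ⟨⟨p₁, p₂⟩, ⟨q₁, q₂⟩, rfl, hp₁, hp₂, hq₁, hq₂⟩ := hL
  obtain ⟨a, b, -, -, hab, h⟩ := hM
  simp only [Prod.smul_mk, Prod.mk_add_mk, Prod.mk.injEq, smul_eq_mul, Set.mem_Icc] at *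
  obtain ⟨h₁, h₂⟩ := h
  subst hp₁ hq₁
  have hb : b = m := by linarith
  have ha : 0 < a := by linarith
  have hb0 : 0 < b := by linarith
  have hp : p₂ = 0 := by
    have h₃ := mul_nonneg hb0.le hq₂.1
    have h₄ := mul_nonneg ha.le hp₂.1
    exact (mul_eq_zero.mp (by linarith : a * p₂ = 0)).resolve_left ha.ne'
  have hq : q₂ = 0 := by
    rw [hp, mul_zero, zero_add] at h₂
    exact (mul_eq_zero.mp h₂).resolve_left hb0.ne'
  rw [hp, hq]

/-- Through any point `M = (m, 0)` with `0 < m < 1` (interior of the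
bottom side) there passes exactly one line of the square geometry whose endpoints
lie on the left and right sides, namely the bottom side itself; every other line
of the square geometry through `M` has its endpoints on the bottom and top sides. -/
theorem square_model_bottom_side_point (m : ℝ) (hm0 : 0 < m) (hm1 : m < 1) :
    (SqLineLR (segment ℝ ((0 : ℝ), (0 : ℝ)) ((1 : ℝ), (0 : ℝ))) ∧
      ((m, 0) : ℝ × ℝ) ∈ segment ℝ ((0 : ℝ), (0 : ℝ)) ((1 : ℝ), (0 : ℝ))) ∧
    (∀ L : Set (ℝ × ℝ), SqLineLR L → ((m, 0) : ℝ × ℝ) ∈ L →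
      L = segment ℝ ((0 : ℝ), (0 : ℝ)) ((1 : ℝ), (0 : ℝ))) ∧
    (∀ L : Set (ℝ × ℝ), SqLine L → ((m, 0) : ℝ × ℝ) ∈ L →
      L ≠ segment ℝ ((0 : ℝ), (0 : ℝ)) ((1 : ℝ), (0 : ℝ)) → SqLineBT L) := by
  refine ⟨⟨⟨(0, 0), (1, 0), rfl, by simp⟩, 1 - m, m, by linarith, hm0.le, by ring, by simp⟩,
    fun L hL hM => hL.eq_bottom_side hm0 hm1 hM, fun L hL hM hne => ?_⟩
  exact hL.resolve_right fun h => hne (h.eq_bottom_side hm0 hm1 hM)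
end
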